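/- arXiv:0905.1302 — 2 statements merged into one kernel-verified Lean document; each statement's English description precedes it below -/
import Mathlib

section
/- The polynomial X⁴ − X³ − X² − X + 1 is irreducible over ℚ, and none of its complex roots is a root of unity. -/
open Polynomial

theorem irreducible_genus_two_poly_zmod_two :
    Irreducible (X^4 - X^3 - X^2 - X + 1 : Polynomial (ZMod 2)) := by
  have hdeg : (X^4 - X^3 - X^2 - X + 1 : Polynomial (ZMod 2)).natDegree = 4 := by
    compute_degree!
  have hmonic : (X^4 - X^3 - X^2 - X + 1 : Polynomial (ZMod 2)).Monic := by
    monicity!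
  have hne : (X^4 - X^3 - X^2 - X + 1 : Polynomial (ZMod 2)) ≠ 1 := by
    intro h
    rw [h] at hdeg
    simp at hdeg
  rw [hmonic.irreducible_iff_lt_natDegree_lt hne]
  rintro q hq hqd ⟨s, hs⟩
  rw [hdeg, Finset.mem_Ioc] at hqd
  have key : ∀ x : ZMod 2, x^4 - x^3 - x^2 - x + 1 ≠ 0 := by decide
  obtain h1 | h2 : q.natDegree = 1 ∨ q.natDegree = 2 := by lia
  · rw [hq.eq_X_add_C h1] at hs
    have := congrArg (eval (-q.coeff 0)) hs
    simp only [eval_add, eval_sub, eval_pow, eval_X, eval_one, eval_mul, eval_C,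
      neg_add_cancel, zero_mul] at this
    exact key _ this
  · have hsm : s.Monic := hq.of_mul_monic_left (by rwa [← hs])
    have hsd : s.natDegree = 2 := by
      have := hq.natDegree_mul hsm
      rw [← hs, hdeg, h2] at this
      lia
    have expand : ∀ p : (ZMod 2)[X], p.Monic → p.natDegree = 2 →
        p = X^2 + C (p.coeff 1) * X + C (p.coeff 0) := by
      intro p hp hpd
      have hlead : p.coeff 2 = 1 := by
        simpa only [hpd] using hp.coeff_natDegree
      conv_lhs => rw [p.as_sum_range_C_mul_X_pow, hpd]
      simp only [Finset.sum_range_succ, Finset.sum_range_zero, hlead, map_one]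
      ring
    rw [expand q hq h2, expand s hsm hsd] at hs
    generalize q.coeff 0 = b, q.coeff 1 = a, s.coeff 0 = d, s.coeff 1 = c at hs
    have hprod : (X^2 + C a * X + C b) * (X^2 + C c * X + C d) =
        X^4 + C (a + c) * X^3 + C (b + d + a * c) * X^2 + C (a * d + b * c) * X + C (b * d) := by
      simp only [map_add, map_mul]
      ring
    rw [hprod] at hs
    have h0 := congrArg (coeff · 0) hs
    have h1 := congrArg (coeff · 1) hs
    have h2 := congrArg (coeff · 2) hs
    have h3 := congrArg (coeff · 3) hs
    simp [coeff_X, coeff_one, coeff_X_pow, coeff_C_mul, -map_add, -map_mul] at h0 h1 h2 h3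
    clear hs hprod
    revert a b c d
    decide

theorem irreducible_genus_two_poly_rat :
    Irreducible (X^4 - X^3 - X^2 - X + 1 : Polynomial ℚ) := by
  have hmonic : (X^4 - X^3 - X^2 - X + 1 : Polynomial ℤ).Monic := by
    monicity!
  have hint : Irreducible (X^4 - X^3 - X^2 - X + 1 : Polynomial ℤ) := by
    refine hmonic.irreducible_of_irreducible_map (Int.castRingHom (ZMod 2)) _ ?_
    simpa using irreducible_genus_two_poly_zmod_two
  simpa using hmonic.irreducible_iff_irreducible_map_fraction_map (K := ℚ) |>.mp hint

theorem exists_one_lt_root_genus_two_poly :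
    ∃ w : ℝ, 1 < w ∧ w^4 - w^3 - w^2 - w + 1 = 0 := by
  have hcont : ContinuousOn (fun w : ℝ => w^4 - w^3 - w^2 - w + 1) (Set.Icc 1 2) := by
    fun_prop
  obtain ⟨w, hw, h0⟩ := intermediate_value_Ioo (by norm_num) hcont
    (show (0 : ℝ) ∈ Set.Ioo _ _ by norm_num)
  exact ⟨w, hw.1, h0⟩

/-- The polynomial `X⁴ − X³ − X² − X + 1` is irreducible over `ℚ`, and none of its
complex roots is a root of unity. -/
theorem genus_two_poly_irreducible_no_root_of_unity :
    Irreducible (X^4 - X^3 - X^2 - X + 1 : Polynomial ℚ) ∧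
      ∀ z : ℂ, z^4 - z^3 - z^2 - z + 1 = 0 → ¬ ∃ n : ℕ, 0 < n ∧ z^n = 1 := by
  refine ⟨irreducible_genus_two_poly_rat, ?_⟩
  rintro z hz ⟨n, hn, hzn⟩
  -- By irreducibility, the real root `w > 1` would satisfy `w ^ n = 1` as well.
  have hdvd : (X^4 - X^3 - X^2 - X + 1 : ℚ[X]) ∣ X^n - 1 := by
    have hmonic : (X^4 - X^3 - X^2 - X + 1 : ℚ[X]).Monic := by monicity!
    rw [minpoly.eq_of_irreducible_of_monic irreducible_genus_two_poly_rat (x := z)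
      (by simpa using hz) hmonic]
    exact minpoly.dvd ℚ z (by simp [hzn])
  obtain ⟨w, hw, hw0⟩ := exists_one_lt_root_genus_two_poly
  have hroot : aeval w (X^n - 1 : ℚ[X]) = 0 :=
    aeval_eq_zero_of_dvd_aeval_eq_zero hdvd (by simpa using hw0)
  have hpow : w^n = 1 := by simpa [sub_eq_zero] using hroot
  exact (one_lt_pow₀ hw hn.ne').ne' hpow
end

section
/- The polynomial X⁶ − X⁴ − X³ − X² + 1 is irreducible over ℚ, and none of its complex roots is a root of unity. -/
open Polynomial

/-- A factor of degree at most `2` is excluded by reduction modulo `3`, and one of degree `3` by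
reduction modulo `2`. -/
theorem irreducible_genus_three_poly_int :
    Irreducible (X ^ 6 - X ^ 4 - X ^ 3 - X ^ 2 + 1 : ℤ[X]) := by
  have hdeg : (X ^ 6 - X ^ 4 - X ^ 3 - X ^ 2 + 1 : ℤ[X]).natDegree = 6 := by
    compute_degree!
  have hmonic : (X ^ 6 - X ^ 4 - X ^ 3 - X ^ 2 + 1 : ℤ[X]).Monic := by
    monicity!
  refine hmonic.irreducible_iff_natDegree'.2 ⟨fun h => ?_, fun f g hf hg hfg hmem => ?_⟩
  · simp [h] at hdeg
  rw [hdeg, Finset.mem_Ioc] at hmem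
  have hsum : f.natDegree + g.natDegree = 6 := by
    rw [← hf.natDegree_mul hg, hfg, hdeg]
  have hcoeff (n : ℕ) := congrArg (coeff · n) hfg
  have hf0 (n : ℕ) (hn : f.natDegree < n) : f.coeff n = 0 := coeff_eq_zero_of_natDegree_lt hn
  have hg0 (n : ℕ) (hn : g.natDegree < n) : g.coeff n = 0 := coeff_eq_zero_of_natDegree_lt hn
  have hf1 : f.coeff f.natDegree = 1 := hf
  have hg1 : g.coeff g.natDegree = 1 := hg
  have h0 := hcoeff 0
  have h1 := hcoeff 1
  have h2 := hcoeff 2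
  have h3 := hcoeff 3
  have h4 := hcoeff 4
  have h5 := hcoeff 5
  simp only [coeff_mul, Finset.Nat.antidiagonal_succ, Finset.Nat.antidiagonal_zero]
    at h0 h1 h2 h3 h4 h5
  simp [coeff_one, coeff_X_pow] at h0 h1 h2 h3 h4 h5
  obtain hd | hd | hd : g.natDegree = 1 ∨ g.natDegree = 2 ∨ g.natDegree = 3 := by lia
  · have hd' : f.natDegree = 5 := by lia
    rw [hd] at hg1 hg0
    rw [hd'] at hf1 hf0
    simp [hg0, hf1, hg1] at h0 h1 h2 h3 h4 h5
    have e4 := eq_sub_of_add_eq h5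
    have e3 := eq_sub_of_add_eq h4
    have e2 := eq_sub_of_add_eq h3
    have e1 := eq_sub_of_add_eq h2
    have e0 := eq_sub_of_add_eq h1
    simp only [e4, e3, e2, e1, e0] at h0
    replace h0 := congrArg (Int.cast : ℤ → ZMod 3) h0
    push_cast at h0
    generalize (g.coeff 0 : ZMod 3) = b0 at h0
    clear * - h0
    revert b0
    decide
  · have hd' : f.natDegree = 4 := by lia
    rw [hd] at hg1 hg0
    rw [hd'] at hf1 hf0
    simp [hf0, hg0, hf1, hg1] at h0 h1 h2 h3 h4 h5
    have e3 := eq_sub_of_add_eq h5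
    have e2 := eq_sub_of_add_eq h4
    have e1 := eq_sub_of_add_eq h3
    have e0 := eq_sub_of_add_eq h2
    simp only [e3, e2, e1, e0] at h0 h1
    replace h0 := congrArg (Int.cast : ℤ → ZMod 3) h0
    replace h1 := congrArg (Int.cast : ℤ → ZMod 3) h1
    push_cast at h0 h1
    generalize (g.coeff 0 : ZMod 3) = b0, (g.coeff 1 : ZMod 3) = b1 at h0 h1
    clear * - h0 h1
    revert b0 b1
    decide
  · have hd' : f.natDegree = 3 := by lia
    rw [hd] at hg1 hg0
    rw [hd'] at hf1 hf0
    simp [hf0, hg0, hf1, hg1] at h0 h1 h2 h3 h4 h5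
    have e2 := eq_sub_of_add_eq h5
    have e1 := eq_sub_of_add_eq h4
    have e0 := eq_sub_of_add_eq h3
    simp only [e2, e1, e0] at h0 h1 h2
    replace h0 := congrArg (Int.cast : ℤ → ZMod 2) h0
    replace h1 := congrArg (Int.cast : ℤ → ZMod 2) h1
    replace h2 := congrArg (Int.cast : ℤ → ZMod 2) h2
    push_cast at h0 h1 h2
    generalize (g.coeff 0 : ZMod 2) = b0, (g.coeff 1 : ZMod 2) = b1,
      (g.coeff 2 : ZMod 2) = b2 at h0 h1 h2
    clear * - h0 h1 h2
    revert b0 b1 b2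
    decide

theorem exists_genus_three_poly_root_mem_Ioo :
    ∃ r ∈ Set.Ioo (0 : ℝ) 1, r ^ 6 - r ^ 4 - r ^ 3 - r ^ 2 + 1 = 0 := by
  refine intermediate_value_Ioo' (f := fun r : ℝ => r ^ 6 - r ^ 4 - r ^ 3 - r ^ 2 + 1)
    zero_le_one (by fun_prop) ?_
  norm_num

/-- The polynomial `X⁶ − X⁴ − X³ − X² + 1` is irreducible over `ℚ`, and none of
its complex roots is a root of unity. -/
theorem genus_three_poly_irreducible_no_root_of_unity :
    Irreducible (X^6 - X^4 - X^3 - X^2 + 1 : Polynomial ℚ) ∧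
      ∀ z : ℂ, z^6 - z^4 - z^3 - z^2 + 1 = 0 → ¬ ∃ n : ℕ, 0 < n ∧ z^n = 1 := by
  have hirr : Irreducible (X ^ 6 - X ^ 4 - X ^ 3 - X ^ 2 + 1 : ℚ[X]) := by
    have hmonic : (X ^ 6 - X ^ 4 - X ^ 3 - X ^ 2 + 1 : ℤ[X]).Monic := by
      monicity!
    simpa using (IsPrimitive.Int.irreducible_iff_irreducible_map_cast hmonic.isPrimitive).1
      irreducible_genus_three_poly_int
  refine ⟨hirr, fun z hz ⟨n, hn, hzn⟩ => ?_⟩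
  have hmonic : (X ^ 6 - X ^ 4 - X ^ 3 - X ^ 2 + 1 : ℚ[X]).Monic := by
    monicity!
  have hdvd : (X ^ 6 - X ^ 4 - X ^ 3 - X ^ 2 + 1 : ℚ[X]) ∣ X ^ n - 1 := by
    rw [minpoly.eq_of_irreducible_of_monic hirr (x := z) (by simpa using hz) hmonic]
    exact minpoly.dvd ℚ z (by simp [hzn])
  obtain ⟨r, hr, hr0⟩ := exists_genus_three_poly_root_mem_Ioo
  have hrn : aeval r (X ^ n - 1 : ℚ[X]) = 0 :=
    aeval_eq_zero_of_dvd_aeval_eq_zero hdvd (by simpa using hr0)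
  have : r ^ n < 1 := pow_lt_one₀ hr.1.le hr.2 hn.ne'
  simp only [map_sub, map_pow, aeval_X, map_one] at hrn
  linarith
end
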